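/- arXiv:1305.0924 — 4 statements merged into one kernel-verified Lean document; each statement's English description precedes it below -/
import Mathlib

section
/- Let p, q > 0. For every z ∈ ℂ∖[0,∞) with z ≠ −1, the Cauchy transforms of the beta prime distribution β'_{p,q} and of the beta distribution β_{p,q} satisfy G̃_{β'_{p,q}}(z) = 1/(z+1) + (1/(z+1)²)·G̃_{β_{p,q}}(z/(z+1)). (For such z, the point z/(z+1) lies in ℂ∖[0,1], so the right-hand side is well defined.) -/
open MeasureTheory Complex Set

/-- The Cauchy transform `∫ 1/(z-x) dμ(x)` of a measure on ℝ. -/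
noncomputable def cauchyT (μ : Measure ℝ) (z : ℂ) : ℂ := ∫ x, (z - (x : ℂ))⁻¹ ∂μ

/-- The Euler beta function `B(p,q) = ∫₀¹ x^(p-1) (1-x)^(q-1) dx`. -/
noncomputable def betaFun (p q : ℝ) : ℝ := ∫ x in Ioo (0:ℝ) 1, x ^ (p - 1) * (1 - x) ^ (q - 1)

/-- The beta distribution `β_{p,q}` on `[0,1]`. -/
noncomputable def betaMeasure (p q : ℝ) : Measure ℝ :=
  volume.withDensity fun x =>
    ENNReal.ofReal ((Ioo (0:ℝ) 1).indicator
      (fun x => x ^ (p - 1) * (1 - x) ^ (q - 1) / betaFun p q) x)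

/-- The beta prime distribution `β'_{p,q}` on `[0,∞)`. -/
noncomputable def betaPrimeMeasure (p q : ℝ) : Measure ℝ :=
  volume.withDensity fun x =>
    ENNReal.ofReal ((Ioi (0:ℝ)).indicator
      (fun x => x ^ (p - 1) * (1 + x) ^ (-(p + q)) / betaFun p q) x)

lemma betaFun_eq_beta {p q : ℝ} (hp : 0 < p) (hq : 0 < q) :
    betaFun p q = ProbabilityTheory.beta p q := by
  rw [ProbabilityTheory.beta_eq_betaIntegralReal p q hp hq, betaIntegral,
    intervalIntegral.integral_of_le zero_le_one, integral_Ioc_eq_integral_Ioo, betaFun,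
    ← Complex.ofReal_re (∫ x in Ioo (0:ℝ) 1, x ^ (p - 1) * (1 - x) ^ (q - 1)),
    ← integral_complex_ofReal]
  congr 1
  refine setIntegral_congr_fun measurableSet_Ioo fun x hx => ?_
  have h1 : 0 ≤ 1 - x := by linarith [hx.2]
  simp [Complex.ofReal_cpow hx.1.le, Complex.ofReal_cpow h1]

lemma betaFun_pos {p q : ℝ} (hp : 0 < p) (hq : 0 < q) : 0 < betaFun p q := by
  rw [betaFun_eq_beta hp hq]
  exact ProbabilityTheory.beta_pos hp hq

/-- The Cauchy transform of a measure with a density supported on `s`, as a set integral. -/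
lemma cauchyT_withDensity_indicator {s : Set ℝ} (hs : MeasurableSet s) {g : ℝ → ℝ}
    (hg : Measurable g) (hg0 : ∀ x ∈ s, 0 ≤ g x) (z : ℂ) :
    cauchyT (volume.withDensity fun x => ENNReal.ofReal (s.indicator g x)) z
      = ∫ x in s, (g x : ℂ) * (z - (x : ℂ))⁻¹ := by
  rw [cauchyT, integral_withDensity_eq_integral_toReal_smul
    (hg.indicator hs).ennreal_ofReal (by simp), ← integral_indicator hs]
  refine integral_congr_ae (.of_forall fun x => ?_)
  by_cases hx : x ∈ s
  · simp [hx, ENNReal.toReal_ofReal (hg0 x hx)]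
  · simp [hx]

lemma image_div_one_sub_Ioo : (fun t : ℝ => t / (1 - t)) '' Ioo 0 1 = Ioi 0 := by
  ext x
  constructor
  · rintro ⟨t, ht, rfl⟩
    exact div_pos ht.1 (by linarith [ht.2])
  · intro (hx : 0 < x)
    refine ⟨x / (1 + x), ⟨by positivity, by rw [div_lt_one] <;> linarith⟩, ?_⟩
    have : 1 - x / (1 + x) = 1 / (1 + x) := by field_simp; ring
    simp only [this]
    field_simp

lemma injOn_div_one_sub_Ioo : InjOn (fun t : ℝ => t / (1 - t)) (Ioo 0 1) := by
  intro a ha b hb hab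
  have h1 : 1 - a ≠ 0 := by linarith [ha.2]
  have h2 : 1 - b ≠ 0 := by linarith [hb.2]
  have := (div_eq_div_iff h1 h2).1 hab
  linarith

lemma hasDerivAt_div_one_sub {t : ℝ} (ht : 1 - t ≠ 0) :
    HasDerivAt (fun t : ℝ => t / (1 - t)) (1 / (1 - t) ^ 2) t := by
  refine ((hasDerivAt_id t).div ((hasDerivAt_id t).const_sub 1) ht).congr_deriv ?_
  simp

lemma integral_Ioi_eq_integral_Ioo_div_one_sub (f : ℝ → ℂ) :
    ∫ x in Ioi (0:ℝ), f x
      = ∫ t in Ioo (0:ℝ) 1, (1 / (1 - t) ^ 2 : ℝ) • f (t / (1 - t)) := by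
  rw [← image_div_one_sub_Ioo, integral_image_eq_integral_abs_deriv_smul measurableSet_Ioo
    (fun t ht => (hasDerivAt_div_one_sub (by linarith [ht.2])).hasDerivWithinAt)
    injOn_div_one_sub_Ioo]
  refine setIntegral_congr_fun measurableSet_Ioo fun t ht => ?_
  rw [abs_of_nonneg (by positivity)]

lemma betaPrime_density_change_of_variables (p q : ℝ) {t : ℝ} (ht : t ∈ Ioo (0:ℝ) 1) :
    1 / (1 - t) ^ 2 * ((t / (1 - t)) ^ (p - 1) * (1 + t / (1 - t)) ^ (-(p + q)))
      = t ^ (p - 1) * (1 - t) ^ (q - 1) := by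
  have h1 : 0 < 1 - t := by linarith [ht.2]
  have h2 : 1 + t / (1 - t) = (1 - t)⁻¹ := by field_simp; ring
  have h3 : 1 / (1 - t) ^ 2 = (1 - t) ^ (-2 : ℝ) := by
    rw [Real.rpow_neg h1.le, one_div]; norm_cast
  rw [h2, h3, Real.div_rpow ht.1.le h1.le, Real.inv_rpow h1.le, ← Real.rpow_neg h1.le,
    div_eq_mul_inv, ← Real.rpow_neg h1.le,
    show q - 1 = -2 + -(p - 1) + - -(p + q) by ring, Real.rpow_add h1, Real.rpow_add h1]
  ring

lemma add_one_mul_ne {z : ℂ} (hz : ∀ x : ℝ, 0 ≤ x → z ≠ (x : ℂ)) {t : ℝ}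
    (ht : t ∈ Icc (0:ℝ) 1) : z - (z + 1) * t ≠ 0 := by
  intro h
  rcases eq_or_lt_of_le ht.2 with rfl | h1
  · simp at h
  · have h2 : ((1 - t : ℝ) : ℂ) ≠ 0 := by exact_mod_cast (by linarith : 1 - t ≠ 0)
    refine hz (t / (1 - t)) (div_nonneg ht.1 (by linarith)) ?_
    rw [Complex.ofReal_div, eq_div_iff h2]
    push_cast
    linear_combination h

theorem stmt_3 (p q : ℝ) (hp : 0 < p) (hq : 0 < q)
    (z : ℂ) (hz : ∀ x : ℝ, 0 ≤ x → z ≠ (x : ℂ)) (hz1 : z ≠ -1) :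
    cauchyT (betaPrimeMeasure p q) z
      = 1 / (z + 1) + (1 / (z + 1) ^ 2) * cauchyT (betaMeasure p q) (z / (z + 1)) := by
  have hB := betaFun_pos hp hq
  have hw : z + 1 ≠ 0 := fun h => hz1 (eq_neg_of_add_eq_zero_left h)
  set d : ℝ → ℝ := fun x => x ^ (p - 1) * (1 - x) ^ (q - 1) / betaFun p q with hd
  have hd1 : ∫ x in Ioo (0:ℝ) 1, d x = 1 := by
    rw [hd, integral_div]
    exact div_self hB.ne'
  have hdint : IntegrableOn d (Ioo 0 1) := by
    by_contra h
    exact zero_ne_one ((integral_undef h).symm.trans hd1)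
  have hne : ∀ t ∈ Icc (0:ℝ) 1, z / (z + 1) - (t : ℂ) ≠ 0 := fun t ht h => by
    refine add_one_mul_ne hz ht ?_
    rw [div_sub' hw, div_eq_zero_iff] at h
    exact h.resolve_right hw
  have hdintC : IntegrableOn (fun t : ℝ => (d t : ℂ)) (Ioo 0 1) := hdint.ofReal
  have hint : IntegrableOn (fun t : ℝ => (d t : ℂ) * (z / (z + 1) - (t : ℂ))⁻¹) (Ioo 0 1) := by
    refine IntegrableOn.mono_set ?_ Ioo_subset_Icc_self
    refine IntegrableOn.mul_continuousOn ?_ (ContinuousOn.inv₀ (by fun_prop) hne) isCompact_Icc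
    exact (integrableOn_Icc_iff_integrableOn_Ioo).2 hdintC
  rw [betaPrimeMeasure, betaMeasure,
    cauchyT_withDensity_indicator measurableSet_Ioi (by fun_prop)
      (fun x (hx : 0 < x) => by positivity),
    cauchyT_withDensity_indicator (g := d) measurableSet_Ioo (by fun_prop) (fun x hx => by
      have := hx.1
      have : 0 < 1 - x := by linarith [hx.2]
      positivity),
    integral_Ioi_eq_integral_Ioo_div_one_sub, ← integral_const_mul]
  have hone : 1 / (z + 1) = ∫ t in Ioo (0:ℝ) 1, 1 / (z + 1) * (d t : ℂ) := by
    rw [integral_const_mul, integral_complex_ofReal, hd1]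
    simp
  rw [hone, ← integral_add (hdintC.const_mul _) (hint.const_mul _)]
  refine setIntegral_congr_fun measurableSet_Ioo fun t ht => ?_
  have h1 : (1 - t : ℂ) ≠ 0 := by exact_mod_cast (by linarith [ht.2] : 1 - t ≠ 0)
  have h2 := add_one_mul_ne hz (Ioo_subset_Icc_self ht)
  have hker : (z - ((t / (1 - t) : ℝ) : ℂ))⁻¹
      = 1 / (z + 1) + 1 / (z + 1) ^ 2 * (z / (z + 1) - (t : ℂ))⁻¹ := by
    have e1 : z - ((t / (1 - t) : ℝ) : ℂ) = (z - (z + 1) * t) / (1 - t) := by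
      push_cast
      field_simp
      ring
    have e2 : z / (z + 1) - (t : ℂ) = (z - (z + 1) * t) / (z + 1) := by
      field_simp
    rw [e1, e2, inv_div, inv_div]
    generalize hv : z - (z + 1) * (t : ℂ) = v at h2 ⊢
    field_simp
    linear_combination hv
  simp only [Complex.real_smul]
  rw [← mul_assoc, ← Complex.ofReal_mul, ← mul_div_assoc,
    betaPrime_density_change_of_variables p q ht, hker]
  simp only [hd]
  ring
end

section
/- Let 0 < a < 1. For every z in the upper half-plane ℂ⁺, the Cauchy transform of the beta distribution β_{a,1−a} is G_{β_{a,1−a}}(z) = (1/z)·(1 − 1/z)^{−a}, where the power is the principal branch (well defined since 1 − 1/z ∈ ℂ∖(−∞,0] for z ∈ ℂ⁺). -/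
open MeasureTheory Complex Set

/-- The integrand of the Euler beta function is integrable on `(0,1)`. -/
lemma integrableOn_betaFun_integrand {p q : ℝ} (hp : 0 < p) (hq : 0 < q) :
    IntegrableOn (fun x : ℝ => x ^ (p - 1) * (1 - x) ^ (q - 1)) (Ioo 0 1) := by
  have h := betaIntegral_convergent (u := (p : ℂ)) (v := (q : ℂ)) (by simpa) (by simpa)
  rw [intervalIntegrable_iff_integrableOn_Ioo_of_le zero_le_one] at h
  refine IntegrableOn.congr_fun h.norm (fun x hx => ?_) measurableSet_Ioo
  have h1 : (0 : ℝ) < 1 - x := by linarith [hx.2]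
  have e : (1 : ℂ) - x = ((1 - x : ℝ) : ℂ) := by push_cast; rfl
  simp only [norm_mul]
  rw [e, norm_cpow_eq_rpow_re_of_pos hx.1, norm_cpow_eq_rpow_re_of_pos h1]
  simp

/-- The segment from `1` to a point of the slit plane stays away from `0`, locally uniformly. -/
lemma exists_pos_le_norm_segment {u : ℂ} (hu : u ∈ slitPlane) :
    ∃ c > 0, ∀ v ∈ Metric.ball u c, ∀ x ∈ Icc (0 : ℝ) 1, c ≤ ‖1 - (x : ℂ) + v * x‖ := by
  obtain ⟨y, hy, hmin⟩ := (isCompact_Icc (a := (0 : ℝ)) (b := 1)).exists_isMinOn ⟨0, by simp⟩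
    (f := fun x : ℝ => ‖1 - (x : ℂ) + u * x‖) (by fun_prop)
  have hy0 : 0 < ‖1 - (y : ℂ) + u * y‖ := by
    have := starConvex_one_slitPlane hu (a := 1 - y) (b := y) (by linarith [hy.2]) hy.1 (by ring)
    have e : (1 - y) • (1 : ℂ) + y • u = 1 - (y : ℂ) + u * y := by
      simp only [real_smul]; push_cast; ring
    rw [e] at this
    exact norm_pos_iff.2 (slitPlane_ne_zero this)
  refine ⟨_, half_pos hy0, fun v hv x hx => ?_⟩
  have h1 : ‖1 - (y : ℂ) + u * y‖ ≤ ‖1 - (x : ℂ) + u * x‖ := hmin hx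
  have h2 : ‖1 - (x : ℂ) + u * x‖ ≤ ‖1 - (x : ℂ) + v * x‖ + ‖(u - v) * x‖ := by
    have e : 1 - (x : ℂ) + u * x = (1 - (x : ℂ) + v * x) + (u - v) * x := by ring
    exact e ▸ norm_add_le _ _
  have h3 : ‖(u - v) * x‖ ≤ ‖u - v‖ := by
    rw [norm_mul, norm_real, Real.norm_of_nonneg hx.1]
    exact mul_le_of_le_one_right (norm_nonneg _) hx.2
  rw [Metric.mem_ball, dist_comm, dist_eq_norm] at hv
  linarith

/-- Integrals of `1 / (1 - x + u x)` against an integrable weight on `(0,1)` are holomorphic in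
`u` on the slit plane. -/
lemma differentiableOn_integral_inv_segment {f : ℝ → ℂ} (hf : IntegrableOn f (Ioo 0 1)) :
    DifferentiableOn ℂ (fun u : ℂ => ∫ x in Ioo (0 : ℝ) 1, f x * (1 - (x : ℂ) + u * x)⁻¹)
      slitPlane := by
  intro u hu
  obtain ⟨c, hc, hb⟩ := exists_pos_le_norm_segment hu
  have hmeas (v : ℂ) : AEStronglyMeasurable (fun x : ℝ => f x * (1 - (x : ℂ) + v * x)⁻¹)
      (volume.restrict (Ioo 0 1)) :=
    hf.aestronglyMeasurable.mul (by fun_prop : Measurable _).aestronglyMeasurable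
  have hmem : ∀ᵐ x : ℝ ∂volume.restrict (Ioo 0 1), x ∈ Ioo (0 : ℝ) 1 :=
    ae_restrict_mem measurableSet_Ioo
  refine (hasDerivAt_integral_of_dominated_loc_of_deriv_le
    (F' := fun v x => f x * (-(x : ℂ) / (1 - (x : ℂ) + v * x) ^ 2))
    (bound := fun x => ‖f x‖ * (1 / c ^ 2)) (Metric.ball_mem_nhds u hc)
    (Filter.Eventually.of_forall hmeas) ?_ ?_ ?_ ?_ ?_).2.differentiableAt.differentiableWithinAt
  · refine (hf.norm.mul_const c⁻¹).mono' (hmeas u) ?_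
    filter_upwards [hmem] with x hx
    rw [norm_mul, norm_inv]
    have := hb u (Metric.mem_ball_self hc) x (Ioo_subset_Icc_self hx)
    gcongr
  · exact hf.aestronglyMeasurable.mul (by fun_prop : Measurable _).aestronglyMeasurable
  · filter_upwards [hmem] with x hx v hv
    have := hb v hv x (Ioo_subset_Icc_self hx)
    have hx1 : |x| ≤ 1 := by rw [abs_of_pos hx.1]; exact hx.2.le
    rw [norm_mul, norm_div, norm_neg, norm_pow, norm_real, Real.norm_eq_abs]
    gcongr
  · exact hf.norm.mul_const _
  · filter_upwards [hmem] with x hx v hv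
    have h0 : 1 - (x : ℂ) + v * x ≠ 0 :=
      norm_pos_iff.1 (hc.trans_le (hb v hv x (Ioo_subset_Icc_self hx)))
    have h1 : HasDerivAt (fun v : ℂ => 1 - (x : ℂ) + v * x) x v := by
      simpa using ((hasDerivAt_id v).mul_const (x : ℂ)).const_add (1 - (x : ℂ))
    exact (h1.inv h0).const_mul (f x)

/-- The Möbius transformation fixing `0` and `1` and rescaling `x / (1 - x)` by `1 / u`. -/
lemma image_mobius_Ioo {u : ℝ} (hu : 0 < u) :
    (fun s : ℝ => s / (u * (1 - s) + s)) '' Ioo 0 1 = Ioo 0 1 := by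
  ext x
  constructor
  · rintro ⟨s, ⟨h0, h1⟩, rfl⟩
    have h : 0 < u * (1 - s) := mul_pos hu (by linarith)
    exact ⟨by positivity, by rw [div_lt_one (by positivity)]; linarith⟩
  · rintro ⟨h0, h1⟩
    have hx : 0 < 1 - x := by linarith
    have hD : 0 < 1 - x + u * x := by positivity
    refine ⟨u * x / (1 - x + u * x), ⟨by positivity, by rw [div_lt_one hD]; linarith⟩, ?_⟩
    have e : u * (1 - u * x / (1 - x + u * x)) + u * x / (1 - x + u * x)
        = u / (1 - x + u * x) := by
      field_simp
      ring
    simp only [e]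
    field_simp

lemma integral_beta_weight_of_pos (a : ℝ) {u : ℝ} (hu : 0 < u) :
    ∫ x in Ioo (0 : ℝ) 1, x ^ (a - 1) * (1 - x) ^ (1 - a - 1) * (1 - x + u * x)⁻¹
      = u ^ (-a) * betaFun a (1 - a) := by
  have hD : ∀ s ∈ Ioo (0 : ℝ) 1, 0 < u * (1 - s) + s := fun s hs =>
    add_pos (mul_pos hu (by linarith [hs.2])) hs.1
  have hderiv : ∀ s ∈ Ioo (0 : ℝ) 1, HasDerivWithinAt (fun s : ℝ => s / (u * (1 - s) + s))
      (u / (u * (1 - s) + s) ^ 2) (Ioo 0 1) s := by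
    intro s hs
    have h1 : HasDerivAt (fun s : ℝ => u * (1 - s) + s) (u * (-1) + 1) s :=
      (((hasDerivAt_id s).const_sub 1).const_mul u).add (hasDerivAt_id s)
    refine (((hasDerivAt_id s).div h1 (hD s hs).ne').congr_deriv ?_).hasDerivWithinAt
    simp only [id]
    congr 1
    ring
  have hinj : InjOn (fun s : ℝ => s / (u * (1 - s) + s)) (Ioo 0 1) := by
    intro s hs t ht h
    have h' := (div_eq_div_iff (hD s hs).ne' (hD t ht).ne').1 h
    have : u * (s - t) = 0 := by linear_combination h'
    rcases mul_eq_zero.1 this with h | h <;> linarith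
  have key := integral_image_eq_integral_abs_deriv_smul measurableSet_Ioo hderiv hinj
    (fun x : ℝ => x ^ (a - 1) * (1 - x) ^ (1 - a - 1) * (1 - x + u * x)⁻¹)
  rw [image_mobius_Ioo hu] at key
  rw [key, betaFun, ← integral_const_mul]
  refine setIntegral_congr_fun measurableSet_Ioo fun s hs => ?_
  have hDs := hD s hs
  have hs0 := hs.1
  have hs1 : 0 < 1 - s := by linarith [hs.2]
  simp only [smul_eq_mul]
  set D := u * (1 - s) + s with hDdef
  have e1 : 1 - s / D = u * (1 - s) / D := by
    field_simp
    rw [hDdef]; ring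
  have e2 : u * (1 - s) / D + u * (s / D) = u / D := by
    field_simp
    ring
  have e3 : D ^ (1 - a - 1) = (D ^ (a - 1))⁻¹ * D⁻¹ := by
    rw [← Real.rpow_neg hDs.le, ← Real.rpow_neg_one D, ← Real.rpow_add hDs]
    congr 1
    ring
  have e4 : u ^ (1 - a - 1) = u ^ (-a) := by
    congr 1
    ring
  rw [e1, e2, Real.div_rpow hs0.le hDs.le, Real.div_rpow (by positivity) hDs.le,
    Real.mul_rpow hu.le hs1.le, abs_of_pos (by positivity), e3, e4]
  have : 0 < D ^ (a - 1) := Real.rpow_pos_of_pos hDs _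
  field_simp

/-- The Euler integral `₂F₁(1, a; 1; 1 - u) = u ^ (-a)` on the slit plane. -/
lemma integral_beta_weight {a : ℝ} (ha0 : 0 < a) (ha1 : a < 1) {u : ℂ} (hu : u ∈ slitPlane) :
    ∫ x in Ioo (0 : ℝ) 1, ((x ^ (a - 1) * (1 - x) ^ (1 - a - 1) : ℝ) : ℂ)
      * (1 - (x : ℂ) + u * x)⁻¹ = u ^ (-(a : ℂ)) * betaFun a (1 - a) := by
  have hf : IntegrableOn (fun x : ℝ => ((x ^ (a - 1) * (1 - x) ^ (1 - a - 1) : ℝ) : ℂ))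
      (Ioo 0 1) := (integrableOn_betaFun_integrand ha0 (sub_pos.2 ha1)).ofReal
  have hL := (differentiableOn_integral_inv_segment hf).analyticOnNhd isOpen_slitPlane
  have hR : AnalyticOnNhd ℂ (fun u : ℂ => u ^ (-(a : ℂ)) * betaFun a (1 - a)) slitPlane := by
    refine DifferentiableOn.analyticOnNhd (fun v hv => ?_) isOpen_slitPlane
    exact ((differentiableAt_id.cpow_const hv).mul_const _).differentiableWithinAt
  have hpos : ∀ t : ℝ, 0 < t →
      ∫ x in Ioo (0 : ℝ) 1, ((x ^ (a - 1) * (1 - x) ^ (1 - a - 1) : ℝ) : ℂ)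
        * (1 - (x : ℂ) + (t : ℂ) * x)⁻¹ = (t : ℂ) ^ (-(a : ℂ)) * betaFun a (1 - a) := by
    intro t ht
    have := congrArg (fun r : ℝ => (r : ℂ)) (integral_beta_weight_of_pos a ht)
    simp only [← integral_complex_ofReal] at this
    rw [← ofReal_neg, ← ofReal_cpow ht.le, ← ofReal_mul, ← this]
    congr 1 with x
    push_cast
    rfl
  refine hL.eqOn_of_preconnected_of_frequently_eq hR
    (starConvex_one_slitPlane.isPathConnected one_mem_slitPlane).isConnected.isPreconnected
    one_mem_slitPlane ?_ hu
  have htend : Filter.Tendsto (fun t : ℝ => (t : ℂ)) (nhdsWithin 1 {1}ᶜ) (nhdsWithin 1 {1}ᶜ) := by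
    refine tendsto_nhdsWithin_iff.2 ⟨?_, ?_⟩
    · simpa using (continuous_ofReal.tendsto 1).mono_left nhdsWithin_le_nhds
    · filter_upwards [self_mem_nhdsWithin] with t ht
      simpa using ht
  refine htend.frequently (Filter.Eventually.frequently ?_)
  filter_upwards [nhdsWithin_le_nhds (Ioi_mem_nhds zero_lt_one)] with t ht
  exact hpos t ht

/-- Integration against the beta distribution. -/
lemma integral_betaMeasure {p q : ℝ} (hp : 0 < p) (hq : 0 < q) (g : ℝ → ℂ) :
    ∫ x, g x ∂betaMeasure p q = (betaFun p q : ℂ)⁻¹ *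
      ∫ x in Ioo (0 : ℝ) 1, ((x ^ (p - 1) * (1 - x) ^ (q - 1) : ℝ) : ℂ) * g x := by
  have hB := betaFun_pos hp hq
  have hm : Measurable fun x : ℝ => ENNReal.ofReal ((Ioo (0:ℝ) 1).indicator
      (fun x => x ^ (p - 1) * (1 - x) ^ (q - 1) / betaFun p q) x) :=
    ((by fun_prop : Measurable fun x : ℝ =>
      x ^ (p - 1) * (1 - x) ^ (q - 1) / betaFun p q).indicator measurableSet_Ioo).ennreal_ofReal
  rw [betaMeasure, integral_withDensity_eq_integral_toReal_smul hm
    (ae_of_all _ fun x => ENNReal.ofReal_lt_top), ← integral_const_mul,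
    ← integral_indicator measurableSet_Ioo]
  congr 1 with x
  by_cases hx : x ∈ Ioo (0 : ℝ) 1
  · have h0 := hx.1
    have h1 : 0 < 1 - x := by linarith [hx.2]
    rw [indicator_of_mem hx, indicator_of_mem hx, ENNReal.toReal_ofReal (by positivity),
      real_smul]
    push_cast
    ring
  · simp [indicator_of_notMem hx]

theorem stmt_5 (a : ℝ) (ha0 : 0 < a) (ha1 : a < 1)
    (z : ℂ) (hz : 0 < z.im) :
    cauchyT (betaMeasure a (1 - a)) z = (1 / z) * (1 - 1 / z) ^ (-(a : ℂ)) := by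
  have hz0 : z ≠ 0 := fun h => by simp [h] at hz
  have hu : 1 - 1 / z ∈ slitPlane := by
    refine Or.inr (ne_of_gt ?_)
    have : 0 < normSq z := normSq_pos.2 hz0
    have : (1 - 1 / z).im = z.im / normSq z := by
      simp [inv_im, neg_div]
    rw [this]
    positivity
  have hB : (betaFun a (1 - a) : ℂ) ≠ 0 :=
    ofReal_ne_zero.2 (betaFun_pos ha0 (sub_pos.2 ha1)).ne'
  have hfac : ∀ x : ℝ, (z - (x : ℂ))⁻¹ = (1 / z) * (1 - (x : ℂ) + (1 - 1 / z) * x)⁻¹ := by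
    intro x
    rw [one_div, ← mul_inv]
    congr 1
    field_simp
    ring
  rw [cauchyT, integral_betaMeasure ha0 (sub_pos.2 ha1)]
  simp_rw [hfac, mul_left_comm _ (1 / z)]
  rw [integral_const_mul, integral_beta_weight ha0 ha1 hu]
  field_simp
end

section
/- Let p, q > 0. There exists a function f analytic on the domain D^b := ℂ∖((−∞,0] ∪ [1,∞)) such that f(z) = G_{β_{p,q}}(z) for all z in the upper half-plane ℂ⁺, and such that for all z in the lower half-plane ℂ⁻ = {Im z < 0} one has f(z) = G̃_{β_{p,q}}(z) − (2πi/B(p,q))·z^{p−1}(1−z)^{q−1}, where the powers z^{p−1} and (1−z)^{q−1} are the principal branches. -/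
open MeasureTheory Complex Set

/-- The domain `D^b = ℂ ∖ ((-∞,0] ∪ [1,∞))`. -/
def betaDomain : Set ℂ := {z : ℂ | ¬ (z.im = 0 ∧ (z.re ≤ 0 ∨ 1 ≤ z.re))}

/-- Differentiation under the integral sign for holomorphic integrands: a dominating function for
the integrand on a ball suffices. -/
theorem differentiableAt_integral_of_dominated_of_differentiableOn {α E : Type*}
    [MeasurableSpace α] {μ : Measure α} [NormedAddCommGroup E] [NormedSpace ℂ E]
    {F : ℂ → α → E} {bound : α → ℝ} {z₀ : ℂ} {R : ℝ} (hR : 0 < R)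
    (hmeas : ∀ z, AEStronglyMeasurable (F z) μ)
    (hdiff : ∀ᵐ a ∂μ, DifferentiableOn ℂ (F · a) (Metric.ball z₀ R))
    (hbound : ∀ᵐ a ∂μ, ∀ z ∈ Metric.ball z₀ R, ‖F z a‖ ≤ bound a)
    (hint : Integrable bound μ) :
    DifferentiableAt ℂ (fun z => ∫ a, F z a ∂μ) z₀ := by
  have hsub {z : ℂ} (hz : z ∈ Metric.ball z₀ (R / 2)) :
      Metric.closedBall z (R / 4) ⊆ Metric.ball z₀ R := by
    refine Metric.closedBall_subset_ball' ?_
    rw [Metric.mem_ball] at hz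
    linarith
  have hball {z : ℂ} (hz : z ∈ Metric.ball z₀ (R / 2)) : Metric.ball z₀ R ∈ nhds z :=
    Metric.isOpen_ball.mem_nhds (Metric.ball_subset_ball (by linarith) hz)
  have hmem : z₀ ∈ Metric.ball z₀ (R / 2) := Metric.mem_ball_self (by positivity)
  refine (hasDerivAt_integral_of_dominated_loc_of_deriv_le (F' := fun z a => deriv (F · a) z)
    (bound := fun a => bound a / (R / 4)) (Metric.ball_mem_nhds z₀ (half_pos hR))
    (.of_forall hmeas) ?_ ?_ ?_ (hint.div_const _) ?_).2.differentiableAt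
  · exact hint.mono' (hmeas z₀) (hbound.mono fun a ha => ha _ (Metric.mem_ball_self hR))
  · refine aestronglyMeasurable_of_tendsto_ae (nhdsWithin z₀ {z₀}ᶜ)
      (f := fun z a => slope (F · a) z₀ z) (fun z => ?_) ?_
    · simp only [slope_def_module]
      exact ((hmeas z).sub (hmeas z₀)).const_smul _
    · filter_upwards [hdiff] with a ha
      exact (ha.differentiableAt (hball hmem)).hasDerivAt.tendsto_slope
  · filter_upwards [hdiff, hbound] with a ha hb z hz
    refine norm_deriv_le_of_forall_mem_sphere_norm_le (by positivity) ?_ fun w hw =>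
      hb w (hsub hz (Metric.sphere_subset_closedBall hw))
    exact (ha.mono (hsub hz)).diffContOnCl_ball subset_rfl
  · filter_upwards [hdiff] with a ha z hz
    exact (ha.differentiableAt (hball hz)).hasDerivAt

/-- If `g` is holomorphic on the closed ball of radius `R` and bounded there by `M`, its divided
differences are bounded on the ball of radius `R / 2`, uniformly in the base point. -/
theorem norm_dslope_le_of_differentiableOn {U : Set ℂ} (hU : IsOpen U) {g : ℂ → ℂ}
    (hg : DifferentiableOn ℂ g U) {z₀ c : ℂ} (hc : c ∈ U) {R M : ℝ} (hR : 0 < R)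
    (hRU : Metric.closedBall z₀ R ⊆ U) (hM : ∀ z ∈ Metric.closedBall z₀ R, ‖g z‖ ≤ M)
    {z : ℂ} (hz : z ∈ Metric.ball z₀ (R / 2)) :
    ‖dslope g c z‖ ≤ (R / 4)⁻¹ * (M + ‖g c‖) := by
  have hd : DifferentiableOn ℂ (dslope g c) U :=
    (differentiableOn_dslope (hU.mem_nhds hc)).mpr hg
  have hfar {w : ℂ} (hw : w ∈ Metric.closedBall z₀ R) (hwc : R / 4 ≤ ‖w - c‖) :
      ‖dslope g c w‖ ≤ (R / 4)⁻¹ * (M + ‖g c‖) := by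
    have hne : w ≠ c := by
      rintro rfl
      simp at hwc
      linarith
    rw [dslope_of_ne _ hne, slope_def_module, norm_smul, norm_inv]
    gcongr
    exact (norm_sub_le _ _).trans (by gcongr; exact hM w hw)
  -- On a sphere of radius `r` that stays away from `c`, apply the maximum principle.
  have hsphere {r : ℝ} (hr : R / 2 ≤ r) (hrR : r ≤ R)
      (hrc : ∀ w ∈ Metric.sphere z₀ r, R / 4 ≤ ‖w - c‖) :
      ‖dslope g c z‖ ≤ (R / 4)⁻¹ * (M + ‖g c‖) := by
    have hr0 : r ≠ 0 := by linarith
    refine norm_le_of_forall_mem_frontier_norm_le (U := Metric.ball z₀ r) Metric.isBounded_ball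
      ((hd.mono hRU).diffContOnCl_ball (Metric.closedBall_subset_closedBall hrR)) ?_
      (subset_closure (Metric.ball_subset_ball hr hz))
    rw [frontier_ball _ hr0]
    exact fun w hw => hfar (Metric.closedBall_subset_closedBall hrR
      (Metric.sphere_subset_closedBall hw)) (hrc w hw)
  rcases le_total (3 * R / 4) ‖c - z₀‖ with h | h
  · refine hsphere (r := R / 2) le_rfl (by linarith) fun w hw => ?_
    rw [mem_sphere_iff_norm] at hw
    have := norm_sub_le_norm_sub_add_norm_sub c w z₀
    rw [norm_sub_rev c w] at this
    linarith
  · refine hsphere (r := R) (by linarith) le_rfl fun w hw => ?_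
    rw [mem_sphere_iff_norm] at hw
    have := norm_sub_le_norm_sub_add_norm_sub w c z₀
    linarith

/-- Away from the diagonal, the divided difference of `g` splits into Cauchy kernels. -/
theorem ae_dslope_ofReal_eq (μ : Measure ℝ) [NullSingletonClass μ] (g : ℂ → ℂ) (z : ℂ) :
    (fun x : ℝ => dslope g x z) =ᵐ[μ] fun x : ℝ => (z - (x : ℂ))⁻¹ * (g z - g x) := by
  filter_upwards [measure_eq_zero_iff_ae_notMem.mp (measure_singleton (μ := μ) z.re)] with x hx
  have hne : z ≠ x := fun h => hx (by simp [h])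
  rw [dslope_of_ne _ hne, slope_def_module, smul_eq_mul]

theorem differentiableOn_integral_dslope {μ : Measure ℝ} [IsFiniteMeasure μ] [NullSingletonClass μ]
    {U : Set ℂ} (hU : IsOpen U) {g : ℂ → ℂ} (hg : DifferentiableOn ℂ g U)
    (hμU : ∀ᵐ x : ℝ ∂μ, (x : ℂ) ∈ U) (hint : Integrable (fun x : ℝ => g x) μ) :
    DifferentiableOn ℂ (fun z => ∫ x : ℝ, dslope g x z ∂μ) U := by
  intro z₀ hz₀
  obtain ⟨R, hR, hRU⟩ := Metric.nhds_basis_closedBall.mem_iff.mp (hU.mem_nhds hz₀)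
  obtain ⟨M, hM⟩ := (isCompact_closedBall z₀ R).exists_bound_of_continuousOn
    (hg.continuousOn.mono hRU)
  refine (differentiableAt_integral_of_dominated_of_differentiableOn (half_pos hR)
    (bound := fun x : ℝ => (R / 4)⁻¹ * (M + ‖g x‖)) (fun z => ?_) ?_ ?_
    (((integrable_const M).add hint.norm).const_mul _)).differentiableWithinAt
  · refine AEStronglyMeasurable.congr ?_ (ae_dslope_ofReal_eq μ g z).symm
    refine AEStronglyMeasurable.mul ?_ (aestronglyMeasurable_const.sub hint.1)
    exact (by fun_prop : Measurable fun x : ℝ => (z - (x : ℂ))⁻¹).aestronglyMeasurable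
  · filter_upwards [hμU] with x hx
    exact ((differentiableOn_dslope (hU.mem_nhds hx)).mpr hg).mono
      ((Metric.ball_subset_ball (by linarith)).trans (Metric.ball_subset_closedBall.trans hRU))
  · filter_upwards [hμU] with x hx z hz
    exact norm_dslope_le_of_differentiableOn hU hg hx hR hRU hM hz

theorem norm_inv_sub_ofReal_le {z : ℂ} (hz : z.im ≠ 0) (x : ℝ) :
    ‖(z - (x : ℂ))⁻¹‖ ≤ |z.im|⁻¹ := by
  rw [norm_inv]
  have := abs_im_le_norm (z - (x : ℂ))
  rw [sub_im, ofReal_im, sub_zero] at this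
  have := abs_pos.mpr hz
  gcongr

theorem integral_inv_sub_mul_eq {μ : Measure ℝ} [IsFiniteMeasure μ] [NullSingletonClass μ] {g : ℂ → ℂ}
    (hint : Integrable (fun x : ℝ => g x) μ) {z : ℂ} (hz : z.im ≠ 0) :
    ∫ x : ℝ, (z - (x : ℂ))⁻¹ * g x ∂μ =
      g z * ∫ x : ℝ, (z - (x : ℂ))⁻¹ ∂μ - ∫ x : ℝ, dslope g x z ∂μ := by
  have hm : AEStronglyMeasurable (fun x : ℝ => (z - (x : ℂ))⁻¹) μ :=
    (by fun_prop : Measurable fun x : ℝ => (z - (x : ℂ))⁻¹).aestronglyMeasurable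
  have hb : ∀ᵐ x : ℝ ∂μ, ‖(z - (x : ℂ))⁻¹‖ ≤ |z.im|⁻¹ :=
    .of_forall (norm_inv_sub_ofReal_le hz)
  have h1 : Integrable (fun x : ℝ => (z - (x : ℂ))⁻¹) μ := .of_bound hm _ hb
  rw [integral_congr_ae (ae_dslope_ofReal_eq μ g z)]
  simp only [mul_sub]
  rw [integral_sub (h1.mul_const _) (hint.bdd_mul hm hb), integral_mul_const]
  ring

theorem integral_inv_sub_Ioo {z : ℂ} (hz : z.im ≠ 0) :
    ∫ x in Ioo (0 : ℝ) 1, (z - (x : ℂ))⁻¹ = log z - log (z - 1) := by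
  have hslit (x : ℝ) : z - x ∈ slitPlane := Or.inr (by simpa using hz)
  have hd (x : ℝ) : HasDerivAt (fun y : ℝ => -log (z - y)) (z - (x : ℂ))⁻¹ x := by
    have := (((ofRealCLM.hasDerivAt (x := x)).const_sub z).clog_real (hslit x)).fun_neg
    simpa [neg_div] using this
  rw [← integral_Ioc_eq_integral_Ioo, ← intervalIntegral.integral_of_le zero_le_one,
    intervalIntegral.integral_eq_sub_of_hasDerivAt (fun x _ => hd x)]
  · simp
    ring
  · refine Continuous.intervalIntegrable ?_ _ _
    exact Continuous.inv₀ (by fun_prop) fun x => slitPlane_ne_zero (hslit x)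

theorem log_sub_one_of_im_pos {z : ℂ} (hz : 0 < z.im) :
    log (z - 1) = log (1 - z) + Real.pi * I := by
  rw [← neg_sub, log, log, norm_neg, arg_neg_eq_arg_add_pi_of_im_neg (by simpa using hz)]
  push_cast
  ring

theorem log_sub_one_of_im_neg {z : ℂ} (hz : z.im < 0) :
    log (z - 1) = log (1 - z) - Real.pi * I := by
  rw [← neg_sub, log, log, norm_neg, arg_neg_eq_arg_sub_pi_of_im_pos (by simpa using hz)]
  push_cast
  ring

theorem mem_betaDomain_iff {z : ℂ} : z ∈ betaDomain ↔ z ∈ slitPlane ∧ 1 - z ∈ slitPlane := by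
  simp only [betaDomain, mem_ofPred_eq, mem_slitPlane_iff, sub_re, sub_im, one_re, one_im]
  grind

theorem isOpen_betaDomain : IsOpen betaDomain := by
  have : betaDomain = slitPlane ∩ (fun z => 1 - z) ⁻¹' slitPlane :=
    Set.ext fun z => mem_betaDomain_iff
  rw [this]
  exact isOpen_slitPlane.inter (isOpen_slitPlane.preimage (by fun_prop))

theorem ofReal_mem_betaDomain {x : ℝ} (hx : x ∈ Ioo (0 : ℝ) 1) : (x : ℂ) ∈ betaDomain := by
  simpa [betaDomain] using hx

/-- The holomorphic extension of the density of `betaMeasure p q` to the slit domain. -/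
noncomputable def betaDensity (p q : ℝ) (z : ℂ) : ℂ :=
  ((betaFun p q : ℝ) : ℂ)⁻¹ * (z ^ ((p : ℂ) - 1) * (1 - z) ^ ((q : ℂ) - 1))

theorem differentiableOn_betaDensity (p q : ℝ) :
    DifferentiableOn ℂ (betaDensity p q) betaDomain := by
  intro z hz
  obtain ⟨h0, h1⟩ := mem_betaDomain_iff.mp hz
  refine DifferentiableAt.differentiableWithinAt (DifferentiableAt.const_mul ?_ _)
  exact (differentiableAt_id.cpow_const h0).mul
    (DifferentiableAt.cpow_const (by fun_prop) h1)

theorem integrableOn_betaDensity {p q : ℝ} (hp : 0 < p) (hq : 0 < q) :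
    IntegrableOn (fun x : ℝ => betaDensity p q x) (Ioo 0 1) := by
  have h := betaIntegral_convergent (u := p) (v := q) (by simpa using hp) (by simpa using hq)
  rw [intervalIntegrable_iff_integrableOn_Ioo_of_le zero_le_one] at h
  exact h.const_mul _

theorem betaFun_nonneg (p q : ℝ) : 0 ≤ betaFun p q := by
  refine setIntegral_nonneg measurableSet_Ioo fun x hx => ?_
  have := hx.1.le
  have := sub_nonneg.mpr hx.2.le
  positivity

theorem betaDensity_ofReal (p q : ℝ) {x : ℝ} (hx : x ∈ Ioo (0 : ℝ) 1) :
    betaDensity p q x = ((x ^ (p - 1) * (1 - x) ^ (q - 1) / betaFun p q : ℝ) : ℂ) := by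
  rw [betaDensity, div_eq_inv_mul]
  push_cast [ofReal_cpow hx.1.le, ofReal_cpow (sub_nonneg.mpr hx.2.le)]
  rfl

theorem cauchyT_betaMeasure (p q : ℝ) (z : ℂ) :
    cauchyT (betaMeasure p q) z =
      ∫ x in Ioo (0 : ℝ) 1, (z - (x : ℂ))⁻¹ * betaDensity p q x := by
  have hmeas : Measurable ((Ioo (0 : ℝ) 1).indicator
      fun x => x ^ (p - 1) * (1 - x) ^ (q - 1) / betaFun p q) :=
    Measurable.indicator (by fun_prop) measurableSet_Ioo
  rw [cauchyT, betaMeasure, integral_withDensity_eq_integral_toReal_smul hmeas.ennreal_ofReal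
    (.of_forall fun _ => ENNReal.ofReal_lt_top), ← integral_indicator measurableSet_Ioo]
  refine integral_congr_ae (.of_forall fun x => ?_)
  by_cases hx : x ∈ Ioo (0 : ℝ) 1
  · have h0 := hx.1.le
    have h1 := sub_nonneg.mpr hx.2.le
    have hB := betaFun_nonneg p q
    simp only [indicator_of_mem hx]
    rw [ENNReal.toReal_ofReal (by positivity), betaDensity_ofReal p q hx, real_smul, mul_comm]
  · simp [indicator_of_notMem hx]

theorem stmt_7 (p q : ℝ) (hp : 0 < p) (hq : 0 < q) :
    ∃ f : ℂ → ℂ, AnalyticOnNhd ℂ f betaDomain ∧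
      (∀ z : ℂ, 0 < z.im → f z = cauchyT (betaMeasure p q) z) ∧
      (∀ z : ℂ, z.im < 0 →
        f z = cauchyT (betaMeasure p q) z
          - (2 * (Real.pi : ℂ) * Complex.I / ((betaFun p q : ℝ) : ℂ))
            * z ^ ((p : ℂ) - 1) * (1 - z) ^ ((q : ℂ) - 1)) := by
  have hint := integrableOn_betaDensity hp hq
  have hG {z : ℂ} (hz : z.im ≠ 0) : cauchyT (betaMeasure p q) z =
      betaDensity p q z * (log z - log (z - 1)) -
        ∫ x in Ioo (0 : ℝ) 1, dslope (betaDensity p q) x z := by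
    rw [cauchyT_betaMeasure, integral_inv_sub_mul_eq hint hz, integral_inv_sub_Ioo hz]
  refine ⟨fun z => betaDensity p q z * (log z - log (1 - z) - Real.pi * I) -
    ∫ x in Ioo (0 : ℝ) 1, dslope (betaDensity p q) x z, ?_, fun z hz => ?_, fun z hz => ?_⟩
  · refine DifferentiableOn.analyticOnNhd ?_ isOpen_betaDomain
    refine ((differentiableOn_betaDensity p q).mul (fun z hz => ?_)).sub
      (differentiableOn_integral_dslope isOpen_betaDomain (differentiableOn_betaDensity p q)
        ((ae_restrict_mem measurableSet_Ioo).mono fun x => ofReal_mem_betaDomain) hint)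
    obtain ⟨h0, h1⟩ := mem_betaDomain_iff.mp hz
    exact (((differentiableAt_id.clog h0).sub
      (DifferentiableAt.clog (by fun_prop) h1)).sub_const _).differentiableWithinAt
  · rw [hG hz.ne', log_sub_one_of_im_pos hz]
    ring
  · rw [hG hz.ne, log_sub_one_of_im_neg hz]
    simp only [betaDensity]
    ring
end

section
/- Let q > 1/2. For every z in the upper half-plane ℂ⁺, the Cauchy transforms of the Student t-distributions satisfy G̃_{t_q}(z) = ((q − 1/2)/q)·((1+z²)·G̃_{t_{q+1}}(z) − z). -/
open MeasureTheory Complex Set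

/-- The Student t-distribution `t_q` on ℝ, with density `(1+x²)^(-q)/B(1/2, q-1/2)`. -/
noncomputable def tMeasure (q : ℝ) : Measure ℝ :=
  volume.withDensity fun x =>
    ENNReal.ofReal ((1 + x ^ 2) ^ (-q) / betaFun (1/2) (q - 1/2))

theorem betaFun_eq_beta_s15 {a b : ℝ} (ha : 0 < a) (hb : 0 < b) :
    betaFun a b = ProbabilityTheory.beta a b := by
  have h : betaIntegral a b = (betaFun a b : ℂ) := by
    rw [betaIntegral, betaFun, intervalIntegral.integral_of_le zero_le_one,
      integral_Ioc_eq_integral_Ioo, ← integral_complex_ofReal]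
    refine setIntegral_congr_fun measurableSet_Ioo fun x hx => ?_
    have h1 : 0 ≤ 1 - x := by linarith [hx.2]
    simp only [ofReal_mul, ofReal_cpow hx.1.le, ofReal_cpow h1]
    push_cast
    rfl
  rw [ProbabilityTheory.beta_eq_betaIntegralReal a b ha hb, h, ofReal_re]

theorem betaFun_pos_s15 {a b : ℝ} (ha : 0 < a) (hb : 0 < b) : 0 < betaFun a b :=
  betaFun_eq_beta_s15 ha hb ▸ ProbabilityTheory.beta_pos ha hb

theorem betaFun_add_one_right {a b : ℝ} (ha : 0 < a) (hb : 0 < b) :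
    betaFun a (b + 1) = b / (a + b) * betaFun a b := by
  rw [betaFun_eq_beta_s15 ha hb, betaFun_eq_beta_s15 ha (by linarith), ProbabilityTheory.beta,
    ProbabilityTheory.beta, ← add_assoc, Real.Gamma_add_one hb.ne',
    Real.Gamma_add_one (by positivity)]
  have := (Real.Gamma_pos_of_pos (add_pos ha hb)).ne'
  field_simp

theorem integrable_one_add_sq_rpow_neg {q : ℝ} (hq : 1 / 2 < q) :
    Integrable fun x : ℝ => (1 + x ^ 2) ^ (-q) := by
  have h := integrable_rpow_neg_one_add_norm_sq (E := ℝ) (μ := volume) (r := 2 * q)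
    (by simp; linarith)
  refine h.congr (Filter.Eventually.of_forall fun x => ?_)
  simp only [Real.norm_eq_abs, sq_abs]
  congr 1
  ring

theorem image_sq_div_one_add_sq_Ioi :
    (fun x : ℝ => x ^ 2 / (1 + x ^ 2)) '' Ioi 0 = Ioo 0 1 := by
  ext u
  constructor
  · rintro ⟨x, hx, rfl⟩
    have hx : 0 < x := hx
    refine ⟨by positivity, ?_⟩
    rw [div_lt_one (by positivity)]
    linarith
  · rintro ⟨h0, h1⟩
    have h2 : 0 < 1 - u := by linarith
    refine ⟨√(u / (1 - u)), Real.sqrt_pos.2 (by positivity), ?_⟩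
    simp only [Real.sq_sqrt (div_pos h0 h2).le]
    field_simp
    ring

theorem injOn_sq_div_one_add_sq_Ioi :
    InjOn (fun x : ℝ => x ^ 2 / (1 + x ^ 2)) (Ioi 0) := by
  intro x hx y hy h
  have hx : 0 < x := hx
  have hy : 0 < y := hy
  simp only at h
  rw [div_eq_div_iff (by positivity) (by positivity)] at h
  exact (pow_left_inj₀ hx.le hy.le two_ne_zero).1 (by linarith)

theorem hasDerivAt_sq_div_one_add_sq (x : ℝ) :
    HasDerivAt (fun x : ℝ => x ^ 2 / (1 + x ^ 2)) (2 * x / (1 + x ^ 2) ^ 2) x := by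
  have h := (hasDerivAt_pow 2 x).div ((hasDerivAt_pow 2 x).const_add 1)
    (by positivity : 1 + x ^ 2 ≠ 0)
  refine h.congr_deriv ?_
  simp only [Nat.cast_ofNat, Nat.add_one_sub_one, pow_one]
  congr 1
  ring

theorem integral_one_add_sq_rpow_neg (q : ℝ) :
    ∫ x : ℝ, (1 + x ^ 2) ^ (-q) = betaFun (1 / 2) (q - 1 / 2) := by
  have h := integral_comp_abs (f := fun x : ℝ => (1 + x ^ 2) ^ (-q))
  simp only [sq_abs] at h
  rw [h, betaFun, ← image_sq_div_one_add_sq_Ioi,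
    integral_image_eq_integral_abs_deriv_smul measurableSet_Ioi
      (fun x _ => (hasDerivAt_sq_div_one_add_sq x).hasDerivWithinAt)
      injOn_sq_div_one_add_sq_Ioi, ← integral_const_mul]
  refine setIntegral_congr_fun measurableSet_Ioi fun x hx => ?_
  have hx : 0 < x := hx
  have hA : 0 < 1 + x ^ 2 := by positivity
  have h1 : 1 - x ^ 2 / (1 + x ^ 2) = (1 + x ^ 2)⁻¹ := by
    field_simp
    ring
  have h2 : (x ^ 2) ^ ((1 : ℝ) / 2 - 1) = x⁻¹ := by
    rw [← Real.rpow_natCast, ← Real.rpow_mul hx.le, ← Real.rpow_neg_one]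
    norm_num
  simp only [smul_eq_mul]
  rw [abs_of_pos (by positivity), h1, Real.div_rpow (by positivity) hA.le, h2,
    Real.inv_rpow hA.le, ← Real.rpow_neg hA.le, div_eq_mul_inv (x⁻¹), ← Real.rpow_neg hA.le,
    mul_assoc x⁻¹, ← Real.rpow_add hA]
  have h3 : (-(1 / 2 - 1) + -(q - 1 / 2 - 1) : ℝ) = -q + (2 : ℕ) := by
    push_cast
    ring
  rw [h3, Real.rpow_add_natCast hA.ne']
  field_simp

theorem one_add_sq_rpow_neg_eq (q x : ℝ) :
    (1 + x ^ 2) ^ (-q) = (1 + x ^ 2) * (1 + x ^ 2) ^ (-(q + 1)) := by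
  have hA : 0 < 1 + x ^ 2 := by positivity
  rw [show -q = 1 + -(q + 1) by ring, Real.rpow_add hA, Real.rpow_one]

theorem integrable_mul_one_add_sq_rpow_neg {q : ℝ} (hq : 1 / 2 < q) :
    Integrable fun x : ℝ => x * (1 + x ^ 2) ^ (-(q + 1)) := by
  refine (integrable_one_add_sq_rpow_neg hq).mono'
    (Measurable.aestronglyMeasurable (by fun_prop)) (Filter.Eventually.of_forall fun x => ?_)
  have hA : 0 < 1 + x ^ 2 := by positivity
  rw [one_add_sq_rpow_neg_eq q, norm_mul, Real.norm_of_nonneg (Real.rpow_nonneg hA.le _),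
    Real.norm_eq_abs]
  gcongr
  nlinarith [sq_abs x, sq_nonneg (|x| - 1), abs_nonneg x]

theorem integral_mul_one_add_sq_rpow (r : ℝ) :
    ∫ x : ℝ, x * (1 + x ^ 2) ^ r = 0 := by
  have h := integral_neg_eq_self (fun x : ℝ => x * (1 + x ^ 2) ^ r) volume
  simp only [neg_mul, neg_sq, integral_neg] at h
  linarith

theorem sub_ofReal_ne_zero {z : ℂ} (hz : 0 < z.im) (x : ℝ) : z - x ≠ 0 := fun h => by
  have := congrArg im h
  simp at this
  linarith

theorem integrable_one_add_sq_rpow_neg_mul_inv_sub {q : ℝ} (hq : 1 / 2 < q) {z : ℂ}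
    (hz : 0 < z.im) :
    Integrable fun x : ℝ => (((1 + x ^ 2) ^ (-q) : ℝ) : ℂ) * (z - x)⁻¹ := by
  refine (integrable_one_add_sq_rpow_neg hq).ofReal.mul_bdd (c := z.im⁻¹)
    (Measurable.aestronglyMeasurable (by fun_prop)) (Filter.Eventually.of_forall fun x => ?_)
  rw [norm_inv]
  gcongr
  calc z.im = (z - x).im := by simp
    _ ≤ |(z - x).im| := le_abs_self _
    _ ≤ ‖z - x‖ := abs_im_le_norm _

theorem cauchyT_tMeasure {q : ℝ} (hq : 1 / 2 < q) (z : ℂ) :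
    cauchyT (tMeasure q) z = (betaFun (1 / 2) (q - 1 / 2) : ℂ)⁻¹ *
      ∫ x : ℝ, (((1 + x ^ 2) ^ (-q) : ℝ) : ℂ) * (z - x)⁻¹ := by
  have hB := betaFun_pos_s15 (a := 1 / 2) (b := q - 1 / 2) (by norm_num) (by linarith)
  rw [cauchyT, tMeasure, integral_withDensity_eq_integral_toReal_smul (by fun_prop) (by simp),
    ← integral_const_mul]
  refine integral_congr_ae (Filter.Eventually.of_forall fun x => ?_)
  have h : 0 ≤ (1 + x ^ 2) ^ (-q) / betaFun (1 / 2) (q - 1 / 2) := by positivity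
  simp only [ENNReal.toReal_ofReal h, real_smul]
  push_cast
  ring

theorem one_add_sq_mul_integral_inv_sub {q : ℝ} (hq : 1 / 2 < q) {z : ℂ} (hz : 0 < z.im) :
    (1 + z ^ 2) * ∫ x : ℝ, (((1 + x ^ 2) ^ (-(q + 1)) : ℝ) : ℂ) * (z - x)⁻¹ =
      (∫ x : ℝ, (((1 + x ^ 2) ^ (-q) : ℝ) : ℂ) * (z - x)⁻¹) +
        z * betaFun (1 / 2) (q + 1 / 2) := by
  have hq' : 1 / 2 < q + 1 := by linarith
  have hI : ∫ x : ℝ, (((1 + x ^ 2) ^ (-(q + 1)) : ℝ) : ℂ) = betaFun (1 / 2) (q + 1 / 2) := by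
    rw [integral_complex_ofReal, integral_one_add_sq_rpow_neg]
    congr 2
    ring
  have hJ : ∫ x : ℝ, ((x * (1 + x ^ 2) ^ (-(q + 1)) : ℝ) : ℂ) = 0 := by
    rw [integral_complex_ofReal, integral_mul_one_add_sq_rpow, ofReal_zero]
  have i1 := integrable_one_add_sq_rpow_neg_mul_inv_sub hq hz
  have i2 : Integrable fun x : ℝ => z * (((1 + x ^ 2) ^ (-(q + 1)) : ℝ) : ℂ) :=
    (integrable_one_add_sq_rpow_neg hq').ofReal.const_mul z
  have i3 : Integrable fun x : ℝ => ((x * (1 + x ^ 2) ^ (-(q + 1)) : ℝ) : ℂ) :=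
    (integrable_mul_one_add_sq_rpow_neg hq).ofReal
  rw [← hI, ← integral_const_mul, ← integral_const_mul, ← integral_add i1 i2,
    ← add_zero (∫ x : ℝ, _ + _), ← hJ, ← integral_add (by exact i1.add i2) i3]
  refine integral_congr_ae (Filter.Eventually.of_forall fun x => ?_)
  have hne := sub_ofReal_ne_zero hz x
  simp only [one_add_sq_rpow_neg_eq q x]
  push_cast
  field_simp
  ring

theorem stmt_15 (q : ℝ) (hq : 1/2 < q)
    (z : ℂ) (hz : 0 < z.im) :
    cauchyT (tMeasure q) z
      = (((q - 1/2) / q : ℝ) : ℂ)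
        * ((1 + z ^ 2) * cauchyT (tMeasure (q + 1)) z - z) := by
  have hq' : 1 / 2 < q + 1 := by linarith
  have hB := betaFun_pos_s15 (a := 1 / 2) (b := q - 1 / 2) (by norm_num) (by linarith)
  have hrec := betaFun_add_one_right (a := 1 / 2) (b := q - 1 / 2) (by norm_num) (by linarith)
  rw [show q - 1 / 2 + 1 = q + 1 / 2 by ring, show 1 / 2 + (q - 1 / 2) = q by ring] at hrec
  have key := one_add_sq_mul_integral_inv_sub hq hz
  rw [cauchyT_tMeasure hq, cauchyT_tMeasure hq', show q + 1 - 1 / 2 = q + 1 / 2 by ring,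
    mul_left_comm (1 + z ^ 2), key, hrec]
  have hc : (((q - 1 / 2) / q : ℝ) : ℂ) ≠ 0 :=
    ofReal_ne_zero.2 (div_pos (by linarith) (by linarith)).ne'
  have hB' : (betaFun (1 / 2) (q - 1 / 2) : ℂ) ≠ 0 := ofReal_ne_zero.2 hB.ne'
  rw [ofReal_mul]
  generalize (((q - 1 / 2) / q : ℝ) : ℂ) = c at hc ⊢
  generalize (betaFun (1 / 2) (q - 1 / 2) : ℂ) = B at hB' ⊢
  field_simp
  ring
end
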